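/- Assume the Riemann Hypothesis. Fix ε > 0 and a weight W as described, and set c₁ = c₂ = 1/2 + ε/2 and c₃′ = 3/4. Then for all large real numbers y > x > 0, R := (1/(2πi))³ ∫_{Re s₁ = c₁} ∫_{Re s₂ = c₂} ∫_{Re s₃ = c₃′} (ζ(s₃) ζ(s₃+s₁−1) ζ(s₃+s₂−1) ζ(s₃+s₁+s₂−2) / (ζ(2s₃+s₁+s₂−2) ζ(s₁) ζ(s₂))) · y^{s₃} x^{s₁+s₂} Ŵ(s₃) Ŵ(s₁) Ŵ(s₂) ds₃ ds₂ ds₁ satisfies |R| ≪ y^{3/4} x^{1+ε}, with an implied constant depending only on ε and W. -/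

import Mathlib

open Complex Filter

/-- The Ramanujan sum `c_q(n) = ∑_{a mod q, gcd(a,q)=1} e(na/q)`. -/
noncomputable def ramanujanSum (q n : ℕ) : ℂ :=
  ∑ a ∈ (Finset.range q).filter (fun a => Nat.Coprime a q),
    Complex.exp (2 * Real.pi * Complex.I * (((n * a : ℕ) : ℂ) / (q : ℂ)))

/-- A smooth weight function attached to a parameter `U ≥ 2`: `0 ≤ W ≤ 1`, supported in
`[1/(2U), 1 + 1/(2U)]`, equal to `1` on `[1/U, 1]`, with `j`-th derivative `≪_j U^j`. -/
structure Weight (U : ℝ) : Type where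
  toFun : ℝ → ℝ
  smooth : ContDiff ℝ (⊤ : ℕ∞) toFun
  nonneg : ∀ t, 0 ≤ toFun t
  le_one : ∀ t, toFun t ≤ 1
  support_subset : ∀ t, t ∉ Set.Icc (1 / (2 * U)) (1 + 1 / (2 * U)) → toFun t = 0
  eq_one : ∀ t ∈ Set.Icc (1 / U) 1, toFun t = 1
  deriv_bound : ∀ j : ℕ, ∃ Cj : ℝ, ∀ t, |iteratedDeriv j toFun t| ≤ Cj * U ^ j

/-- The Mellin transform `Ŵ(s) = ∫_0^∞ W(t) t^{s-1} dt`. -/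
noncomputable def mellinW (W : ℝ → ℝ) (s : ℂ) : ℂ :=
  ∫ t in Set.Ioi (0 : ℝ), (W t : ℂ) * (t : ℂ) ^ (s - 1)

/-- `(1/(2πi)) ∫_{Re s = c} f(s) ds`, the normalized vertical line integral. -/
noncomputable def VI (c : ℝ) (f : ℂ → ℂ) : ℂ :=
  (1 / (2 * Real.pi * Complex.I)) * ∫ t : ℝ, f (c + t * Complex.I) * Complex.I

/-- The smoothed second moment `C(x,y) = ∑_n (∑_q c_q(n) W(q/x))² W(n/y)`. -/
noncomputable def Cxy {U : ℝ} (W : Weight U) (x y : ℝ) : ℂ :=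
  ∑' n : ℕ+, (∑' q : ℕ+, ramanujanSum q n * (W.toFun ((q : ℕ) / x) : ℂ)) ^ 2
    * (W.toFun ((n : ℕ) / y) : ℂ)

/-- The generalized divisor sum `σ_z(n) = ∑_{d ∣ n} d^z`. -/
noncomputable def sigmaC (z : ℂ) (n : ℕ) : ℂ := ∑ d ∈ n.divisors, (d : ℂ) ^ z

/-- The entire function `(s - 1) ζ(s)`, with the removable singularity at `1` filled in. -/
noncomputable def zetaMulSubOne : ℂ → ℂ :=
  Function.update (fun s => (s - 1) * riemannZeta s) 1 1

lemma zetaMulSubOne_of_ne {s : ℂ} (hs : s ≠ 1) :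
    zetaMulSubOne s = (s - 1) * riemannZeta s := Function.update_of_ne hs _ _

lemma zetaMulSubOne_one : zetaMulSubOne 1 = 1 := Function.update_self ..

lemma differentiable_zetaMulSubOne : Differentiable ℂ zetaMulSubOne := by
  rw [← differentiableOn_univ,
    ← differentiableOn_compl_singleton_and_continuousAt_iff (c := (1 : ℂ)) univ_mem]
  refine ⟨fun s hs => ?_, ?_⟩
  · have hs1 : s ≠ 1 := by simpa using hs
    refine DifferentiableAt.differentiableWithinAt ?_
    have : DifferentiableAt ℂ (fun s => (s - 1) * riemannZeta s) s :=
      (by fun_prop : DifferentiableAt ℂ (fun s : ℂ => s - 1) s).mul (differentiableAt_riemannZeta hs1)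
    refine this.congr_of_eventuallyEq ?_
    filter_upwards [isOpen_ne.mem_nhds hs1] with z hz using zetaMulSubOne_of_ne hz
  · exact continuousAt_update_same.mpr riemannZeta_residue_one

/-- `s - 1` times the error of the trapezoidal rule for `u ↦ u ^ (-s)` on `[n + 1, n + 2]`. -/
noncomputable def trapezoidError (n : ℕ) (s : ℂ) : ℂ :=
  (s - 1) * (((n + 1 : ℝ) : ℂ) ^ (-s) + ((n + 2 : ℝ) : ℂ) ^ (-s)) / 2
    - (((n + 1 : ℝ) : ℂ) ^ (1 - s) - ((n + 2 : ℝ) : ℂ) ^ (1 - s))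

lemma differentiable_trapezoidError (n : ℕ) : Differentiable ℂ (trapezoidError n) := by
  have h1 : ((n + 1 : ℝ) : ℂ) ≠ 0 := by norm_cast
  have h2 : ((n + 2 : ℝ) : ℂ) ≠ 0 := by norm_cast
  unfold trapezoidError
  intro s
  have a1 : DifferentiableAt ℂ (fun s : ℂ => ((n + 1 : ℝ) : ℂ) ^ (-s)) s :=
    DifferentiableAt.const_cpow (by fun_prop) (Or.inl h1)
  have a2 : DifferentiableAt ℂ (fun s : ℂ => ((n + 2 : ℝ) : ℂ) ^ (-s)) s :=
    DifferentiableAt.const_cpow (by fun_prop) (Or.inl h2)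
  have a3 : DifferentiableAt ℂ (fun s : ℂ => ((n + 1 : ℝ) : ℂ) ^ (1 - s)) s :=
    DifferentiableAt.const_cpow (by fun_prop) (Or.inl h1)
  have a4 : DifferentiableAt ℂ (fun s : ℂ => ((n + 2 : ℝ) : ℂ) ^ (1 - s)) s :=
    DifferentiableAt.const_cpow (by fun_prop) (Or.inl h2)
  fun_prop

lemma hasDerivAt_ofReal_add_cpow {a : ℝ} (ha : 0 < a) {v : ℝ} (hv : 0 ≤ v) (r : ℂ) :
    HasDerivAt (fun v : ℝ => ((a + v : ℝ) : ℂ) ^ r) (r * ((a + v : ℝ) : ℂ) ^ (r - 1)) v := by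
  have h1 : HasDerivAt (fun v : ℝ => ((a + v : ℝ) : ℂ)) 1 v := by
    simpa using ((hasDerivAt_id v).const_add a).ofReal_comp
  have h2 : ((a + v : ℝ) : ℂ) ∈ slitPlane := by
    rw [ofReal_mem_slitPlane]; positivity
  simpa [Function.comp_def] using ((hasDerivAt_id ((a + v : ℝ) : ℂ)).cpow_const (c := r) h2).comp v h1

lemma norm_trapezoidError_le (n : ℕ) {s : ℂ} (hs : -2 ≤ s.re) :
    ‖trapezoidError n s‖ ≤ ‖s - 1‖ * ‖s‖ * ‖s + 1‖ * (n + 1 : ℝ) ^ (-s.re - 2) := by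
  set a : ℝ := n + 1 with ha
  have ha0 : 0 < a := by positivity
  set M : ℝ := ‖s - 1‖ * ‖s‖ * ‖s + 1‖ * a ^ (-s.re - 2) with hM
  have hM0 : 0 ≤ M := by positivity
  let f (v : ℝ) : ℂ := (s - 1) * ((a : ℂ) ^ (-s) + ((a + v : ℝ) : ℂ) ^ (-s)) * v / 2
    - ((a : ℂ) ^ (1 - s) - ((a + v : ℝ) : ℂ) ^ (1 - s))
  let g (v : ℝ) : ℂ := (s - 1) * (((a : ℂ) ^ (-s) - ((a + v : ℝ) : ℂ) ^ (-s)) / 2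
    - s * v * ((a + v : ℝ) : ℂ) ^ (-s - 1) / 2)
  let h (v : ℝ) : ℂ := (s - 1) * s * (s + 1) * v / 2 * ((a + v : ℝ) : ℂ) ^ (-s - 2)
  have hid (v : ℝ) : HasDerivAt (fun v : ℝ => (v : ℂ)) 1 v := by
    simpa using (hasDerivAt_id v).ofReal_comp
  have hf (v : ℝ) (hv : 0 ≤ v) : HasDerivAt f (g v) v := by
    have d1 := hasDerivAt_ofReal_add_cpow ha0 hv (-s)
    have d2 := hasDerivAt_ofReal_add_cpow ha0 hv (1 - s)
    have := ((((d1.const_add ((a : ℂ) ^ (-s))).const_mul (s - 1)).mul (hid v)).div_const 2).sub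
      (d2.const_sub ((a : ℂ) ^ (1 - s)))
    refine this.congr_deriv ?_
    simp only [g]
    rw [show 1 - s - 1 = -s by ring]
    ring
  have hg (v : ℝ) (hv : 0 ≤ v) : HasDerivAt g (h v) v := by
    have d1 := hasDerivAt_ofReal_add_cpow ha0 hv (-s)
    have d2 := hasDerivAt_ofReal_add_cpow ha0 hv (-s - 1)
    have := (((d1.const_sub ((a : ℂ) ^ (-s))).div_const 2).sub
      ((((hid v).const_mul s).mul d2).div_const 2)).const_mul (s - 1)
    refine this.congr_deriv ?_
    simp only [h]
    rw [show -s - 1 - 1 = -s - 2 by ring]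
    ring
  have hh (v : ℝ) (hv : v ∈ Set.Ico (0 : ℝ) 1) : ‖h v‖ ≤ M := by
    have hav : 0 < a + v := by linarith [hv.1]
    simp only [h, norm_mul, norm_div, norm_cpow_eq_rpow_re_of_pos hav, hM]
    have e1 : (a + v) ^ (-s - 2).re ≤ a ^ (-s.re - 2) := by
      have : (-s - 2).re = -s.re - 2 := by simp
      rw [this]
      exact Real.rpow_le_rpow_of_nonpos ha0 (by linarith [hv.1]) (by linarith)
    have e2 : ‖(v : ℂ)‖ ≤ 1 := by
      rw [Complex.norm_real, Real.norm_of_nonneg hv.1]; exact hv.2.le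
    have e3 : ‖(2 : ℂ)‖ = 2 := by simp
    rw [e3]
    have : ‖s - 1‖ * ‖s‖ * ‖s + 1‖ * ‖(v : ℂ)‖ / 2 ≤ ‖s - 1‖ * ‖s‖ * ‖s + 1‖ := by
      have hp : 0 ≤ ‖s - 1‖ * ‖s‖ * ‖s + 1‖ := by positivity
      nlinarith [norm_nonneg (v : ℂ)]
    gcongr
  have hgb (v : ℝ) (hv : v ∈ Set.Ico (0 : ℝ) 1) : ‖g v‖ ≤ M := by
    have := norm_image_sub_le_of_norm_deriv_le_segment' (f := g) (f' := h) (a := 0) (b := 1) (C := M)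
      (fun x hx => (hg x hx.1).hasDerivWithinAt) hh v ⟨hv.1, hv.2.le⟩
    have g0 : g 0 = 0 := by simp [g]
    rw [g0, sub_zero, sub_zero] at this
    nlinarith [hv.1, hv.2]
  have key := norm_image_sub_le_of_norm_deriv_le_segment_01' (f := f) (f' := g) (C := M)
      (fun x hx => (hf x hx.1).hasDerivWithinAt) hgb
  have f0 : f 0 = 0 := by simp [f]
  have f1 : f 1 = trapezoidError n s := by
    simp only [f, trapezoidError, ha]
    norm_num [add_assoc]
  rwa [f0, sub_zero, f1] at key

lemma summable_add_one_rpow {r : ℝ} (hr : r < -1) : Summable fun n : ℕ => (n + 1 : ℝ) ^ r := by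
  have := (summable_nat_add_iff (f := fun n : ℕ => (n : ℝ) ^ r) 1).mpr
    (Real.summable_nat_rpow.mpr hr)
  simpa using this

lemma summable_trapezoidError {s : ℂ} (hs : -1 < s.re) :
    Summable fun n => trapezoidError n s :=
  .of_norm_bounded ((summable_add_one_rpow (by linarith)).mul_left _)
    fun n => norm_trapezoidError_le n (by linarith)

lemma norm_tsum_trapezoidError_le {σ : ℝ} (hσ : -1 < σ) {s : ℂ} (hs : σ ≤ s.re) :
    ‖∑' n, trapezoidError n s‖ ≤
      ‖s - 1‖ * ‖s‖ * ‖s + 1‖ * ∑' n : ℕ, (n + 1 : ℝ) ^ (-σ - 2) := by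
  rw [← tsum_mul_left]
  refine tsum_of_norm_bounded ((summable_add_one_rpow (by linarith)).mul_left _).hasSum
    fun n => (norm_trapezoidError_le n (by linarith)).trans ?_
  gcongr
  simp

lemma differentiableOn_tsum_trapezoidError :
    DifferentiableOn ℂ (fun s => ∑' n, trapezoidError n s) {s | -1 < s.re} := by
  intro s (hs : -1 < s.re)
  obtain ⟨σ, hσ, hσs⟩ := exists_between hs
  let V : Set ℂ := {z | σ < z.re} ∩ Metric.ball 0 (‖s‖ + 1)
  have hV : IsOpen V := (isOpen_lt continuous_const continuous_re).inter Metric.isOpen_ball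
  have hsV : s ∈ V := ⟨hσs, by simp⟩
  have : DifferentiableOn ℂ (fun s => ∑' n, trapezoidError n s) V := by
    refine differentiableOn_tsum_of_summable_norm
      (u := fun n : ℕ => (‖s‖ + 2) * (‖s‖ + 1) * (‖s‖ + 2) * (n + 1 : ℝ) ^ (-σ - 2))
      ((summable_add_one_rpow (by linarith)).mul_left _)
      (fun n => (differentiable_trapezoidError n).differentiableOn) hV fun n z hz => ?_
    have hz1 : σ < z.re := hz.1
    have hz2 : ‖z‖ < ‖s‖ + 1 := by simpa using hz.2
    refine (norm_trapezoidError_le n (by linarith)).trans ?_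
    have h1 : ‖z - 1‖ ≤ ‖s‖ + 2 := (norm_sub_le _ _).trans (by simp; linarith)
    have h2 : ‖z + 1‖ ≤ ‖s‖ + 2 := (norm_add_le _ _).trans (by simp; linarith)
    gcongr
    simp
  exact (this.differentiableAt (hV.mem_nhds hsV)).differentiableWithinAt

lemma tsum_trapezoidError_of_one_lt_re {s : ℂ} (hs : 1 < s.re) :
    ∑' n, trapezoidError n s = (s - 1) * riemannZeta s - (s - 1) / 2 - 1 := by
  have h1 : Summable fun n : ℕ => ((n + 1 : ℝ) : ℂ) ^ (-s) := by
    have := (summable_nat_add_iff (f := fun n : ℕ => 1 / (n : ℂ) ^ s) 1).mpr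
      (Complex.summable_one_div_nat_cpow.mpr hs)
    refine this.congr fun n => ?_
    rw [cpow_neg, one_div]
    push_cast; rfl
  have hz : ∑' n : ℕ, ((n + 1 : ℝ) : ℂ) ^ (-s) = riemannZeta s := by
    rw [zeta_eq_tsum_one_div_nat_add_one_cpow hs]
    refine tsum_congr fun n => ?_
    rw [cpow_neg, one_div]
    push_cast; rfl
  have t1 : Tendsto (fun N : ℕ => ∑ n ∈ Finset.range N, ((n + 1 : ℝ) : ℂ) ^ (-s)) atTop
      (nhds (riemannZeta s)) := hz ▸ h1.hasSum.tendsto_sum_nat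
  have t0 : Tendsto (fun N : ℕ => ((N + 1 : ℝ) : ℂ) ^ (-s)) atTop (nhds 0) :=
    h1.tendsto_atTop_zero
  have t2 : Tendsto (fun N : ℕ => ((N + 1 : ℝ) : ℂ) ^ (1 - s)) atTop (nhds 0) := by
    rw [tendsto_zero_iff_norm_tendsto_zero]
    have : Tendsto (fun N : ℕ => (N + 1 : ℝ) ^ (-(s.re - 1))) atTop (nhds 0) :=
      (tendsto_rpow_neg_atTop (by linarith)).comp
        (tendsto_atTop_add_const_right _ _ tendsto_natCast_atTop_atTop)
    refine this.congr fun N => ?_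
    rw [norm_cpow_eq_rpow_re_of_pos (by positivity)]
    simp
  have hp (N : ℕ) : ∑ n ∈ Finset.range N, trapezoidError n s =
      (s - 1) / 2 * (2 * ∑ n ∈ Finset.range N, ((n + 1 : ℝ) : ℂ) ^ (-s)
        + ((N + 1 : ℝ) : ℂ) ^ (-s) - 1) - (1 - ((N + 1 : ℝ) : ℂ) ^ (1 - s)) := by
    induction N with
    | zero => simp
    | succ N ih =>
      rw [Finset.sum_range_succ, Finset.sum_range_succ, ih, trapezoidError]
      have : (((N + 1 : ℕ) : ℝ) + 1 : ℝ) = N + 2 := by push_cast; ring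
      rw [this]
      ring
  have t3 := (((t1.const_mul 2).add t0).sub_const 1 |>.const_mul ((s - 1) / 2)).sub
    (t2.const_sub 1)
  have t4 := (summable_trapezoidError (s := s) (by linarith)).hasSum.tendsto_sum_nat
  rw [tendsto_nhds_unique t4 (t3.congr fun N => (hp N).symm)]
  ring

lemma zetaMulSubOne_eq {s : ℂ} (hs : -1 < s.re) :
    zetaMulSubOne s = ∑' n, trapezoidError n s + (s - 1) / 2 + 1 := by
  have hU : IsOpen {s : ℂ | -1 < s.re} := isOpen_lt continuous_const continuous_re
  have hA : AnalyticOnNhd ℂ zetaMulSubOne {s | -1 < s.re} :=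
    differentiable_zetaMulSubOne.differentiableOn.analyticOnNhd hU
  have hB : AnalyticOnNhd ℂ (fun s => ∑' n, trapezoidError n s + (s - 1) / 2 + 1)
      {s | -1 < s.re} := by
    refine DifferentiableOn.analyticOnNhd ?_ hU
    exact (differentiableOn_tsum_trapezoidError.add (by fun_prop)).add (by fun_prop)
  refine hA.eqOn_of_preconnected_of_eventuallyEq hB
    (convex_halfSpace_re_gt (-1)).isPreconnected (z₀ := 2) (by norm_num) ?_ hs
  filter_upwards [(isOpen_lt continuous_const continuous_re).mem_nhds
    (show (1 : ℝ) < (2 : ℂ).re by norm_num)] with z hz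
  have hz' : 1 < z.re := hz
  rw [tsum_trapezoidError_of_one_lt_re hz', zetaMulSubOne_of_ne (by rintro rfl; simp at hz')]
  ring

lemma exists_norm_zetaMulSubOne_le {σ : ℝ} (hσ : -1 < σ) :
    ∃ K : ℝ, 1 ≤ K ∧ ∀ s : ℂ, σ ≤ s.re → ‖zetaMulSubOne s‖ ≤ K * (1 + ‖s‖) ^ 3 := by
  set S := ∑' n : ℕ, (n + 1 : ℝ) ^ (-σ - 2)
  have hS : 0 ≤ S := tsum_nonneg fun n => by positivity
  refine ⟨S + 2, by linarith, fun s hs => ?_⟩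
  rw [zetaMulSubOne_eq (by linarith)]
  have h0 := norm_nonneg s
  have h1 : ‖s - 1‖ ≤ 1 + ‖s‖ := (norm_sub_le _ _).trans (by simp [add_comm])
  have h2 : ‖s + 1‖ ≤ 1 + ‖s‖ := (norm_add_le _ _).trans (by simp [add_comm])
  have h3 : ‖∑' n, trapezoidError n s‖ ≤ (1 + ‖s‖) * (1 + ‖s‖) * (1 + ‖s‖) * S :=
    (norm_tsum_trapezoidError_le hσ hs).trans (by gcongr; linarith)
  have h4 : ‖(s - 1) / 2‖ ≤ 1 + ‖s‖ := by rw [norm_div]; simp; linarith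
  have h5 : 1 + ‖s‖ ≤ (1 + ‖s‖) ^ 3 := le_self_pow₀ (by linarith) (by norm_num)
  calc _ ≤ ‖∑' n, trapezoidError n s‖ + ‖(s - 1) / 2‖ + ‖(1 : ℂ)‖ := norm_add₃_le
    _ ≤ (S + 2) * (1 + ‖s‖) ^ 3 := by rw [norm_one]; nlinarith

lemma one_add_norm_add_mul_I_le (c t : ℝ) :
    1 + ‖(c : ℂ) + t * I‖ ≤ (1 + |c|) * (1 + |t|) := by
  have : ‖(c : ℂ) + t * I‖ ≤ |c| + |t| := (norm_add_le _ _).trans (by simp)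
  nlinarith [abs_nonneg c, abs_nonneg t]

/-- Polynomial growth of `ζ` on vertical lines to the right of `Re s = -1`. -/
lemma exists_norm_riemannZeta_le {c : ℝ} (hc : -1 < c) (hc1 : c ≠ 1) :
    ∃ K : ℝ, 0 < K ∧ ∃ A : ℕ, ∀ t : ℝ, ‖riemannZeta (c + t * I)‖ ≤ K * (1 + |t|) ^ A := by
  obtain ⟨K, hK, h⟩ := exists_norm_zetaMulSubOne_le hc
  have hc0 : 0 < |c - 1| := abs_pos.mpr (sub_ne_zero.mpr hc1)
  refine ⟨K * (1 + |c|) ^ 3 / |c - 1|, by positivity, 3, fun t => ?_⟩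
  have hs : (c : ℂ) + t * I ≠ 1 := fun h => hc1 (by simpa using congrArg re h)
  have h1 := h (c + t * I) (by simp)
  rw [zetaMulSubOne_of_ne hs, norm_mul] at h1
  have h2 : |c - 1| ≤ ‖(c : ℂ) + t * I - 1‖ := by
    simpa using abs_re_le_norm ((c : ℂ) + t * I - 1)
  have h3 : |c - 1| * ‖riemannZeta (c + t * I)‖ ≤ K * ((1 + |c|) * (1 + |t|)) ^ 3 :=
    calc _ ≤ _ := mul_le_mul_of_nonneg_right h2 (norm_nonneg _)
      _ ≤ _ := h1
      _ ≤ _ := by gcongr; exact one_add_norm_add_mul_I_le c t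
  rw [div_mul_eq_mul_div, le_div_iff₀ hc0]
  calc _ = |c - 1| * ‖riemannZeta (c + t * I)‖ := mul_comm _ _
    _ ≤ _ := h3
    _ = _ := by ring

/-- A nonvanishing holomorphic function on a disc has a holomorphic logarithm. -/
lemma exists_eq_mul_exp {f : ℂ → ℂ} {R : ℝ} (hR : 0 < R)
    (hf : DifferentiableOn ℂ f (Metric.ball 0 R)) (h0 : ∀ z ∈ Metric.ball 0 R, f z ≠ 0) :
    ∃ g : ℂ → ℂ, g 0 = 0 ∧ DifferentiableOn ℂ g (Metric.ball 0 R) ∧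
      ∀ z ∈ Metric.ball 0 R, f z = f 0 * exp (g z) := by
  have hd : DifferentiableOn ℂ (fun z => deriv f z / f z) (Metric.ball 0 R) :=
    (hf.deriv Metric.isOpen_ball).div hf h0
  obtain ⟨g, hg0, hg⟩ := hd.isExactOn_ball.with_val_at 0 0
  refine ⟨g, hg0, fun z hz => (hg z hz).differentiableAt.differentiableWithinAt, fun z hz => ?_⟩
  have hder (w : ℂ) (hw : w ∈ Metric.ball (0 : ℂ) R) :
      HasDerivAt (fun w => f w * exp (-g w)) 0 w := by
    have h1 := (hf.differentiableAt (Metric.isOpen_ball.mem_nhds hw)).hasDerivAt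
    refine (h1.mul (hg w hw).neg.cexp).congr_deriv ?_
    have := h0 w hw
    simp only [Pi.neg_apply]
    field_simp
    ring
  have hc := Metric.isOpen_ball.is_const_of_deriv_eq_zero
    (convex_ball (0 : ℂ) R).isPreconnected
    (fun w hw => (hder w hw).differentiableAt.differentiableWithinAt)
    (fun w hw => (hder w hw).deriv) hz (Metric.mem_ball_self hR)
  simp only [hg0, neg_zero, exp_zero, mul_one] at hc
  rw [← hc, mul_assoc, ← exp_add, neg_add_cancel, exp_zero, mul_one]

/-- An upper bound for a nonvanishing holomorphic function on a disc yields a lower bound on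
smaller discs. -/
lemma norm_div_norm_le_rpow {f : ℂ → ℂ} {R B : ℝ} (hB : 1 < B)
    (hf : DifferentiableOn ℂ f (Metric.ball 0 R)) (h0 : ∀ z ∈ Metric.ball 0 R, f z ≠ 0)
    (hfB : ∀ z ∈ Metric.ball 0 R, ‖f z‖ ≤ B * ‖f 0‖) {z : ℂ} (hz : z ∈ Metric.ball 0 R) :
    ‖f 0‖ / ‖f z‖ ≤ B ^ (2 * ‖z‖ / (R - ‖z‖)) := by
  have hR : 0 < R := Metric.pos_of_mem_ball hz
  obtain ⟨g, hg0, hg, hfg⟩ := exists_eq_mul_exp hR hf h0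
  have hf0 : 0 < ‖f 0‖ := norm_pos_iff.mpr (h0 0 (Metric.mem_ball_self hR))
  have hB0 : 0 < B := by linarith
  have hmap : Set.MapsTo g (Metric.ball 0 R) {z | z.re ≤ Real.log B} := by
    intro w hw
    have := hfB w hw
    rw [hfg w hw, norm_mul, norm_exp, mul_comm B, mul_le_mul_iff_of_pos_left hf0] at this
    exact (Real.le_log_iff_exp_le hB0).mpr this
  have key := borelCaratheodory_zero (Real.log_pos hB) hg hmap hR hz hg0
  rw [hfg z hz, norm_mul, norm_exp, div_mul_cancel_left₀ hf0.ne', ← Real.exp_neg,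
    Real.rpow_def_of_pos hB0]
  refine Real.exp_le_exp.mpr ?_
  calc -(g z).re ≤ ‖g z‖ := (neg_le_abs _).trans (abs_re_le_norm _)
    _ ≤ _ := key
    _ = _ := by ring

lemma zetaMulSubOne_ne_zero (hRH : RiemannHypothesis) {s : ℂ} (hs : 1 / 2 < s.re) :
    zetaMulSubOne s ≠ 0 := by
  rcases eq_or_ne s 1 with rfl | h1
  · simp [zetaMulSubOne_one]
  · rw [zetaMulSubOne_of_ne h1]
    refine mul_ne_zero (sub_ne_zero.mpr h1) fun h => ?_
    have := hRH s h ?_ h1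
    · linarith
    · rintro ⟨n, rfl⟩
      have : (-2 * ((n : ℂ) + 1)).re = -2 * (n + 1) := by simp
      rw [this] at hs
      have : (0 : ℝ) ≤ n := n.cast_nonneg
      linarith

lemma riemannZeta_ne_zero (hRH : RiemannHypothesis) {s : ℂ} (hs : 1 / 2 < s.re) :
    riemannZeta s ≠ 0 := by
  rcases eq_or_ne s 1 with rfl | h1
  · exact riemannZeta_one_ne_zero
  · have := zetaMulSubOne_ne_zero hRH hs
    rw [zetaMulSubOne_of_ne h1] at this
    exact right_ne_zero_of_mul this

open scoped ArithmeticFunction.Moebius in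
/-- `1 / ζ` is bounded on `Re s ≥ 2`. -/
lemma exists_norm_inv_riemannZeta_le_of_two_le :
    ∃ Z : ℝ, 1 < Z ∧ ∀ s : ℂ, 2 ≤ s.re → ‖riemannZeta s‖⁻¹ ≤ Z := by
  have hsum : LSeriesSummable (fun n => (μ n : ℂ)) 2 :=
    ArithmeticFunction.LSeriesSummable_moebius_iff.mpr (by norm_num)
  refine ⟨∑' n, ‖LSeries.term (fun n => (μ n : ℂ)) 2 n‖ + 2, ?_, fun s hs => ?_⟩
  · have : 0 ≤ ∑' n, ‖LSeries.term (fun n => (μ n : ℂ)) 2 n‖ := tsum_nonneg fun n => norm_nonneg _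
    linarith
  · have h := ArithmeticFunction.LSeries_zeta_mul_Lseries_moebius (s := s) (by linarith)
    rw [ArithmeticFunction.LSeries_zeta_eq_riemannZeta (by linarith)] at h
    rw [← norm_inv, inv_eq_of_mul_eq_one_right h]
    have : ‖LSeries (fun n => (μ n : ℂ)) s‖ ≤ ∑' n, ‖LSeries.term (fun n => (μ n : ℂ)) 2 n‖ :=
      tsum_of_norm_bounded hsum.norm.hasSum
        fun n => LSeries.norm_term_le_of_re_le_re _ (by simpa using hs) n
    linarith

/-- Under RH, `1 / ζ` has polynomial growth on vertical lines to the right of `Re s = 1 / 2`. -/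
lemma exists_norm_inv_riemannZeta_le (hRH : RiemannHypothesis) {c : ℝ} (hc : 1 / 2 < c) :
    ∃ K : ℝ, 0 < K ∧ ∃ A : ℕ, ∀ t : ℝ, ‖riemannZeta (c + t * I)‖⁻¹ ≤ K * (1 + |t|) ^ A := by
  obtain ⟨K, hK, hKs⟩ := exists_norm_zetaMulSubOne_le (σ := 1 / 2) (by norm_num)
  obtain ⟨Z, hZ, hZs⟩ := exists_norm_inv_riemannZeta_le_of_two_le
  set R : ℝ := c + 3 / 2 with hR
  set L : ℝ := 1 + (c + 2) + R with hL
  set n : ℕ := ⌈4 / (R - 2)⌉₊ with hn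
  have hL1 : 1 ≤ L := by linarith
  refine ⟨(1 + |c|) * Z * (K * L ^ 3 * Z) ^ n + ‖riemannZeta 1‖⁻¹, by positivity, 3 * n + 1,
    fun t => ?_⟩
  have hJ : 1 ≤ 1 + |t| := by simp
  rcases eq_or_ne ((c : ℂ) + t * I) 1 with h1 | h1
  · rw [h1]
    have : 1 ≤ (1 + |t|) ^ (3 * n + 1) := one_le_pow₀ hJ
    have h2 : 0 < (1 + |c|) * Z * (K * L ^ 3 * Z) ^ n := by positivity
    nlinarith [norm_nonneg (riemannZeta 1), inv_nonneg.mpr (norm_nonneg (riemannZeta 1))]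
  set a : ℂ := ((c + 2 : ℝ) : ℂ) + t * I with ha
  have hare : a.re = c + 2 := by simp [ha]
  have ha1 : a ≠ 1 := fun h => by rw [h] at hare; simp at hare; linarith
  have hare' (z : ℂ) (hz : z ∈ Metric.ball (0 : ℂ) R) : 1 / 2 < (a + z).re := by
    have : |z.re| < R := (abs_re_le_norm z).trans_lt (by simpa using hz)
    rw [add_re, hare]
    linarith [neg_abs_le z.re]
  let f (z : ℂ) : ℂ := zetaMulSubOne (a + z)
  have hf0 : Z⁻¹ ≤ ‖f 0‖ := by
    have h2 : 1 ≤ ‖a - 1‖ := by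
      have := (le_abs_self _).trans (abs_re_le_norm (a - 1))
      simp only [sub_re, hare, one_re] at this
      linarith
    have h3 : Z⁻¹ ≤ ‖riemannZeta a‖ := inv_le_of_inv_le₀
      (norm_pos_iff.mpr (riemannZeta_ne_zero hRH (by linarith))) (hZs a (by linarith))
    simp only [f, add_zero, zetaMulSubOne_of_ne ha1, norm_mul]
    have : 0 < Z⁻¹ := by positivity
    nlinarith
  set B : ℝ := K * L ^ 3 * Z * (1 + |t|) ^ 3 with hB
  have hL3 : 1 ≤ L ^ 3 := one_le_pow₀ hL1
  have hJ3 : 1 ≤ (1 + |t|) ^ 3 := one_le_pow₀ hJ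
  have hB1 : 1 < B :=
    calc 1 < Z := hZ
      _ = 1 * 1 * Z * 1 := by ring
      _ ≤ B := by rw [hB]; gcongr
  have hfB (z : ℂ) (hz : z ∈ Metric.ball (0 : ℂ) R) : ‖f z‖ ≤ B * ‖f 0‖ := by
    have h2 : 1 + ‖a + z‖ ≤ L * (1 + |t|) := by
      have hz' : ‖z‖ < R := by simpa using hz
      have h3 : ‖a‖ ≤ (c + 2) + |t| := (norm_add_le _ _).trans (by
        rw [Complex.norm_real, Real.norm_of_nonneg (by linarith)]; simp)
      have h4 := norm_add_le a z
      nlinarith [abs_nonneg t]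
    calc ‖f z‖ ≤ K * (1 + ‖a + z‖) ^ 3 := hKs _ (hare' z hz).le
      _ ≤ K * (L * (1 + |t|)) ^ 3 := by gcongr
      _ = B * Z⁻¹ := by rw [hB]; field_simp
      _ ≤ B * ‖f 0‖ := by gcongr
  have hz : (-2 : ℂ) ∈ Metric.ball (0 : ℂ) R := by simp; linarith
  have key := norm_div_norm_le_rpow hB1
    (differentiable_zetaMulSubOne.comp (by fun_prop : Differentiable ℂ fun z => a + z)).differentiableOn
    (fun z hz => zetaMulSubOne_ne_zero hRH (hare' z hz)) hfB hz
  have hn2 : B ^ (2 * ‖(-2 : ℂ)‖ / (R - ‖(-2 : ℂ)‖)) ≤ B ^ n := by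
    rw [← Real.rpow_natCast]
    refine Real.rpow_le_rpow_of_exponent_le hB1.le ?_
    refine le_trans (le_of_eq ?_) (Nat.le_ceil _)
    norm_num
  have hval : f (-2) = (c + t * I - 1) * riemannZeta (c + t * I) := by
    rw [← zetaMulSubOne_of_ne h1]
    simp only [f, ha]
    congr 1
    push_cast; ring
  have hfz : 0 < ‖f (-2)‖ := norm_pos_iff.mpr (zetaMulSubOne_ne_zero hRH (hare' _ hz))
  have h4 : ‖f (-2)‖⁻¹ ≤ Z * B ^ n := by
    have h5 : Z⁻¹ * ‖f (-2)‖⁻¹ ≤ B ^ n :=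
      calc Z⁻¹ * ‖f (-2)‖⁻¹ ≤ ‖f 0‖ * ‖f (-2)‖⁻¹ := by gcongr
        _ ≤ B ^ n := key.trans hn2
    rwa [inv_mul_le_iff₀ (by linarith)] at h5
  have h6 : ‖riemannZeta (c + t * I)‖⁻¹ = ‖(c : ℂ) + t * I - 1‖ * ‖f (-2)‖⁻¹ := by
    have : ‖(c : ℂ) + t * I - 1‖ ≠ 0 := norm_ne_zero_iff.mpr (sub_ne_zero.mpr h1)
    rw [hval, norm_mul]
    field_simp
  have h7 : ‖(c : ℂ) + t * I - 1‖ ≤ (1 + |c|) * (1 + |t|) := by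
    refine (norm_sub_le _ _).trans ?_
    rw [norm_one, add_comm]
    exact one_add_norm_add_mul_I_le c t
  calc ‖riemannZeta (c + t * I)‖⁻¹ ≤ (1 + |c|) * (1 + |t|) * (Z * B ^ n) := by
        rw [h6]; gcongr
    _ = (1 + |c|) * Z * (K * L ^ 3 * Z) ^ n * (1 + |t|) ^ (3 * n + 1) := by
        rw [hB, mul_pow, ← pow_mul]; ring
    _ ≤ _ := by
        gcongr
        simp

lemma mellinW_eq_mellin (W : ℝ → ℝ) (s : ℂ) : mellinW W s = mellin (fun t => (W t : ℂ)) s := by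
  simp only [mellinW, mellin, smul_eq_mul, mul_comm]

namespace Weight

variable {U : ℝ}

lemma eq_zero_of_lt (W : Weight U) {t : ℝ} (ht : t < 1 / (2 * U)) : W.toFun t = 0 :=
  W.support_subset t fun h => by linarith [h.1]

lemma eq_zero_of_gt (W : Weight U) {t : ℝ} (ht : 1 + 1 / (2 * U) < t) : W.toFun t = 0 :=
  W.support_subset t fun h => by linarith [h.2]

lemma exists_norm_mellinW_mul_le (W : Weight U) (hU : 0 < U) (c : ℝ) (N : ℕ) :
    ∃ D : ℝ, 0 < D ∧ ∀ t : ℝ,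
      ‖mellinW W.toFun (c + t * I)‖ * (1 + |t|) ^ N ≤ D * (1 + t ^ 2)⁻¹ := by
  let f (u : ℝ) : ℂ := Real.exp (-c * u) • (W.toFun (Real.exp (-u)) : ℂ)
  have hf1 : HasCompactSupport f := by
    refine HasCompactSupport.intro
      (isCompact_Icc (a := -Real.log (1 + 1 / (2 * U))) (b := -Real.log (1 / (2 * U)))) fun u hu => ?_
    have : W.toFun (Real.exp (-u)) = 0 := by
      rw [Set.mem_Icc, not_and_or, not_le, not_le] at hu
      rcases hu with hu | hu
      · exact W.eq_zero_of_gt ((Real.log_lt_iff_lt_exp (by positivity)).mp (by linarith))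
      · exact W.eq_zero_of_lt ((Real.lt_log_iff_exp_lt (by positivity)).mp (by linarith))
    simp [f, this]
  have hf2 : ContDiff ℝ (⊤ : ℕ∞) f := by
    have h1 : ContDiff ℝ (⊤ : ℕ∞) fun u : ℝ => Real.exp (-c * u) := by fun_prop
    have h2 : ContDiff ℝ (⊤ : ℕ∞) fun u : ℝ => W.toFun (Real.exp (-u)) :=
      W.smooth.comp (by fun_prop)
    exact h1.smul (ofRealCLM.contDiff.comp h2)
  let F : SchwartzMap ℝ ℂ := FourierTransform.fourier (hf1.toSchwartzMap hf2)
  have hF (t : ℝ) : mellinW W.toFun (c + t * I) = F (t / (2 * Real.pi)) := by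
    rw [mellinW_eq_mellin, mellin_eq_fourier, SchwartzMap.fourier_coe]
    simp only [add_re, ofReal_re, mul_re, I_re, mul_zero, ofReal_im, I_im, mul_one, sub_self,
      add_zero, add_im, mul_im, zero_add]
    rfl
  obtain ⟨C₀, hC₀, h0⟩ := F.decay 0 0
  obtain ⟨C₁, hC₁, h1⟩ := F.decay (N + 2) 0
  simp only [norm_iteratedFDeriv_zero] at h0 h1
  refine ⟨2 ^ (N + 1) * (C₀ + (2 * Real.pi) ^ (N + 2) * C₁), by positivity, fun t => ?_⟩
  rw [← div_eq_mul_inv, le_div_iff₀ (by positivity), hF]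
  have h2 : 1 + t ^ 2 ≤ (1 + |t|) ^ 2 := by
    rw [← sq_abs t]
    nlinarith [abs_nonneg t]
  have h3 : (1 + |t|) ^ (N + 2) ≤ 2 ^ (N + 1) * (1 + |t| ^ (N + 2)) := by
    simpa using add_pow_le zero_le_one (abs_nonneg t) (N + 2)
  have h4 : |t| ^ (N + 2) * ‖F (t / (2 * Real.pi))‖ ≤ (2 * Real.pi) ^ (N + 2) * C₁ := by
    have := h1 (t / (2 * Real.pi))
    rw [norm_div, Real.norm_eq_abs, Real.norm_of_nonneg (by positivity : 0 ≤ 2 * Real.pi),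
      div_pow, div_mul_eq_mul_div, div_le_iff₀ (by positivity)] at this
    linarith
  have h5 : ‖F (t / (2 * Real.pi))‖ ≤ C₀ := by simpa using h0 (t / (2 * Real.pi))
  calc ‖F (t / (2 * Real.pi))‖ * (1 + |t|) ^ N * (1 + t ^ 2)
      ≤ ‖F (t / (2 * Real.pi))‖ * (1 + |t|) ^ N * (1 + |t|) ^ 2 := by gcongr
    _ = ‖F (t / (2 * Real.pi))‖ * (1 + |t|) ^ (N + 2) := by ring
    _ ≤ ‖F (t / (2 * Real.pi))‖ * (2 ^ (N + 1) * (1 + |t| ^ (N + 2))) := by gcongr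
    _ = 2 ^ (N + 1) * (‖F (t / (2 * Real.pi))‖ +
          |t| ^ (N + 2) * ‖F (t / (2 * Real.pi))‖) := by ring
    _ ≤ _ := by gcongr

lemma differentiable_mellinW (W : Weight U) (hU : 0 < U) :
    Differentiable ℂ (mellinW W.toFun) := by
  intro s
  rw [show mellinW W.toFun = mellin (fun t => (W.toFun t : ℂ)) from
    funext (mellinW_eq_mellin W.toFun)]
  refine mellin_differentiableAt_of_isBigO_rpow (a := s.re + 1) (b := s.re - 1) ?_ ?_ (by linarith)
    ?_ (by linarith)
  · exact (continuous_ofReal.comp W.smooth.continuous).locallyIntegrable.locallyIntegrableOn _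
  · refine EventuallyEq.trans_isBigO ?_ (Asymptotics.isBigO_zero _ _)
    filter_upwards [eventually_gt_atTop (1 + 1 / (2 * U))] with t ht
    simp [W.eq_zero_of_gt ht]
  · refine EventuallyEq.trans_isBigO ?_ (Asymptotics.isBigO_zero _ _)
    filter_upwards [nhdsWithin_le_nhds (Iio_mem_nhds (by positivity : 0 < 1 / (2 * U)))] with t ht
    simp [W.eq_zero_of_lt ht]

lemma mellinW_one_ne_zero (W : Weight U) (hU : 1 < U) : mellinW W.toFun 1 ≠ 0 := by
  have h1 : mellinW W.toFun 1 = ((∫ t in Set.Ioi (0 : ℝ), W.toFun t : ℝ) : ℂ) := by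
    simp only [mellinW, sub_self, cpow_zero, mul_one]
    exact integral_ofReal
  rw [h1, ofReal_ne_zero]
  have hcs : HasCompactSupport W.toFun :=
    HasCompactSupport.intro (isCompact_Icc (a := 1 / (2 * U)) (b := 1 + 1 / (2 * U)))
      fun t ht => W.support_subset t ht
  have hi := W.smooth.continuous.integrable_of_hasCompactSupport hcs (μ := MeasureTheory.volume)
  have hsub : Set.Icc (1 / U) 1 ⊆ Set.Ioi 0 := fun t ht =>
    (by positivity : 0 < 1 / U).trans_le ht.1
  have h2 : ∫ t in Set.Icc (1 / U) 1, W.toFun t ≤ ∫ t in Set.Ioi (0 : ℝ), W.toFun t :=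
    MeasureTheory.setIntegral_mono_set hi.integrableOn (.of_forall W.nonneg)
      hsub.eventuallyLE
  have h3 : ∫ t in Set.Icc (1 / U) 1, W.toFun t = 1 - 1 / U := by
    rw [MeasureTheory.setIntegral_congr_fun measurableSet_Icc W.eq_one]
    have : 1 / U ≤ 1 := by rw [div_le_one (by linarith)]; exact hU.le
    simp at this ⊢
    exact this
  have h4 : 1 / U < 1 := by rw [div_lt_one (by linarith)]; exact hU
  linarith

lemma countable_zeros_mellinW (W : Weight U) (hU : 1 < U) :
    {s | mellinW W.toFun s = 0}.Countable := by
  have hA : AnalyticOnNhd ℂ (mellinW W.toFun) Set.univ :=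
    (W.differentiable_mellinW (by linarith)).differentiableOn.analyticOnNhd isOpen_univ
  have h := hA.preimage_zero_mem_codiscreteWithin (W.mellinW_one_ne_zero hU) (Set.mem_univ _)
    isConnected_univ
  have : DiscreteTopology {s | mellinW W.toFun s = 0} := by
    have := (mem_codiscrete'.mp h).2
    rw [← Set.preimage_compl, compl_compl] at this
    exact isDiscrete_iff_discreteTopology.mp this
  exact Set.countable_coe_iff.mp (TopologicalSpace.separableSpace_iff_countable.mp inferInstance)

lemma ae_mellinW_ne_zero (W : Weight U) (hU : 1 < U) {φ : ℝ → ℂ} (hφ : Function.Injective φ) :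
    ∀ᵐ t, mellinW W.toFun (φ t) ≠ 0 :=
  MeasureTheory.measure_mono_null (fun _ h => not_not.mp h)
    (((W.countable_zeros_mellinW hU).preimage_of_injOn hφ.injOn).measure_zero _)

end Weight

lemma norm_VI_le {c b : ℝ} {f : ℂ → ℂ} (hb : 0 ≤ b)
    (h : ∀ t : ℝ, ‖f (c + t * I)‖ ≤ b * (1 + t ^ 2)⁻¹) : ‖VI c f‖ ≤ b := by
  have h1 : ‖∫ t : ℝ, f (c + t * I) * I‖ ≤ b * Real.pi := by
    rw [← integral_univ_inv_one_add_sq, ← MeasureTheory.integral_const_mul]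
    refine MeasureTheory.norm_integral_le_of_norm_le (integrable_inv_one_add_sq.const_mul b)
      (.of_forall fun t => ?_)
    simpa using h t
  have hpi := Real.pi_pos
  have h2 : ‖(1 / (2 * Real.pi * I) : ℂ)‖ = 1 / (2 * Real.pi) := by
    simp [abs_of_pos hpi]
  rw [VI, norm_mul, h2]
  calc 1 / (2 * Real.pi) * ‖∫ t : ℝ, f (c + t * I) * I‖ ≤ 1 / (2 * Real.pi) * (b * Real.pi) := by
        gcongr
    _ = b / 2 := by field_simp
    _ ≤ b := by linarith

lemma VI_eq_zero_of_ae {c : ℝ} {f : ℂ → ℂ} (h : ∀ᵐ t : ℝ, f (c + t * I) = 0) : VI c f = 0 := by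
  rw [VI, MeasureTheory.integral_eq_zero_of_ae (h.mono fun t ht => by simp [ht]), mul_zero]

/-- With the junk value `0` for divergent integrals, a vertical integral through a pole of `ζ`
vanishes. -/
lemma VI_eq_zero_of_pole {c t₀ : ℝ} {f : ℂ → ℂ} {φ : ℝ → ℂ} (hφ : ContinuousAt φ t₀)
    (hφ0 : φ t₀ ≠ 0)
    (hf : ∀ t : ℝ, f (c + t * I) = riemannZeta (1 + (t - t₀ : ℝ) * I) * φ t) : VI c f = 0 := by
  rw [VI, MeasureTheory.integral_undef, mul_zero]
  intro hi
  have hpole : Tendsto (fun t : ℝ => (1 + ((t - t₀ : ℝ) : ℂ) * I)) (nhdsWithin t₀ {t₀}ᶜ)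
      (nhdsWithin 1 {1}ᶜ) := by
    refine tendsto_nhdsWithin_iff.mpr ⟨?_, ?_⟩
    · have : ContinuousAt (fun t : ℝ => (1 + ((t - t₀ : ℝ) : ℂ) * I)) t₀ := by fun_prop
      simpa [ContinuousAt] using this.tendsto.mono_left nhdsWithin_le_nhds
    · filter_upwards [self_mem_nhdsWithin] with t ht
      have : ((t - t₀ : ℝ) : ℂ) ≠ 0 := ofReal_ne_zero.mpr (sub_ne_zero.mpr ht)
      simpa using this
  have h1 := ((riemannZeta_residue_one.comp hpole).mul
    (hφ.tendsto.mono_left nhdsWithin_le_nhds)).norm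
  have h2 : ‖φ t₀‖ / 2 < ‖1 * φ t₀‖ := by
    rw [one_mul]; exact half_lt_self (norm_pos_iff.mpr hφ0)
  have hO : (fun t : ℝ => (t - t₀)⁻¹) =O[nhdsWithin t₀ {t₀}ᶜ] fun t : ℝ => f (c + t * I) * I := by
    refine Asymptotics.IsBigO.of_bound (‖φ t₀‖ / 2)⁻¹ ?_
    filter_upwards [h1.eventually_const_lt h2, self_mem_nhdsWithin] with t ht htne
    have hne : 0 < |t - t₀| := abs_pos.mpr (sub_ne_zero.mpr htne)
    have h3 : ‖f (c + t * I) * I‖ * |t - t₀| > ‖φ t₀‖ / 2 := by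
      rw [hf, norm_mul, norm_mul, norm_I, mul_one]
      simp only [Function.comp_apply, add_sub_cancel_left, norm_mul, norm_I, mul_one,
        Complex.norm_real, Real.norm_eq_abs] at ht
      linarith
    rw [Real.norm_eq_abs, abs_inv, inv_mul_eq_div, le_div_iff₀ (by positivity),
      inv_mul_le_iff₀ hne]
    linarith
  exact not_intervalIntegrable_of_sub_inv_isBigO_punctured hO (a := t₀) (b := t₀ + 1) (by simp)
    (by simp) hi.intervalIntegrable

/-- The integrand of the triple integral `R`. -/
noncomputable def RIntegrand (W : ℝ → ℝ) (x y : ℝ) (s₁ s₂ s₃ : ℂ) : ℂ :=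
  riemannZeta s₃ * riemannZeta (s₃ + s₁ - 1) * riemannZeta (s₃ + s₂ - 1) *
      riemannZeta (s₃ + s₁ + s₂ - 2) /
      (riemannZeta (2 * s₃ + s₁ + s₂ - 2) * riemannZeta s₁ * riemannZeta s₂) *
    (y : ℂ) ^ s₃ * (x : ℂ) ^ (s₁ + s₂) *
    mellinW W s₃ * mellinW W s₁ * mellinW W s₂

lemma continuousAt_riemannZeta_line {g : ℝ → ℂ} {t : ℝ} (hg : Continuous g) (h : g t ≠ 1) :
    ContinuousAt (fun t => riemannZeta (g t)) t :=
  (differentiableAt_riemannZeta h).continuousAt.comp' hg.continuousAt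

/-- The contour passes through the pole of `ζ(s₃ + s₁ + s₂ - 2)`. -/
lemma VI_RIntegrand_eq_zero_of_sum {U : ℝ} (hRH : RiemannHypothesis) (hU : 1 < U) (W : Weight U)
    {x y : ℝ} (hx : 0 < x) (hy : 0 < y) {t₁ t₂ : ℝ} {s₁ s₂ : ℂ}
    (hs₁ : s₁ = (9 / 8 : ℝ) + t₁ * I) (hs₂ : s₂ = (9 / 8 : ℝ) + t₂ * I)
    (h1 : mellinW W.toFun s₁ ≠ 0) (h2 : mellinW W.toFun s₂ ≠ 0)
    (h3 : mellinW W.toFun ((3 / 4 : ℝ) + (-t₁ - t₂ : ℝ) * I) ≠ 0) :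
    VI (3 / 4) (RIntegrand W.toFun x y s₁ s₂) = 0 := by
  have hxC : (x : ℂ) ≠ 0 := ofReal_ne_zero.mpr hx.ne'
  have hyC : (y : ℂ) ≠ 0 := ofReal_ne_zero.mpr hy.ne'
  let s (t : ℝ) : ℂ := (3 / 4 : ℝ) + t * I
  have hs : Continuous s := by fun_prop
  have re1 : s₁.re = 9 / 8 := by simp [hs₁]
  have re2 : s₂.re = 9 / 8 := by simp [hs₂]
  have re3 (t : ℝ) : (s t).re = 3 / 4 := by simp [s]
  have hne {z : ℂ} (hz : z.re ≠ 1) : z ≠ 1 := fun h => hz (by simp [h])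
  refine VI_eq_zero_of_pole (t₀ := -t₁ - t₂) (φ := fun t =>
    riemannZeta (s t) * riemannZeta (s t + s₁ - 1) * riemannZeta (s t + s₂ - 1) /
      (riemannZeta (2 * s t + s₁ + s₂ - 2) * riemannZeta s₁ * riemannZeta s₂) *
    (y : ℂ) ^ s t * (x : ℂ) ^ (s₁ + s₂) *
    mellinW W.toFun (s t) * mellinW W.toFun s₁ * mellinW W.toFun s₂) ?_ ?_ ?_
  · have c1 : ContinuousAt (fun t => riemannZeta (s t)) (-t₁ - t₂) :=
      continuousAt_riemannZeta_line hs (hne (by rw [re3]; norm_num))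
    have c2 : ContinuousAt (fun t => riemannZeta (s t + s₁ - 1)) (-t₁ - t₂) :=
      continuousAt_riemannZeta_line (by fun_prop) (hne (by simp [re3, re1]; norm_num))
    have c3 : ContinuousAt (fun t => riemannZeta (s t + s₂ - 1)) (-t₁ - t₂) :=
      continuousAt_riemannZeta_line (by fun_prop) (hne (by simp [re3, re2]; norm_num))
    have c4 : ContinuousAt (fun t => riemannZeta (2 * s t + s₁ + s₂ - 2)) (-t₁ - t₂) :=
      continuousAt_riemannZeta_line (by fun_prop) (hne (by simp [re3, re1, re2]; norm_num))
    have c5 : ContinuousAt (fun t => (y : ℂ) ^ s t) (-t₁ - t₂) :=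
      hs.continuousAt.const_cpow (Or.inl hyC)
    have c6 : ContinuousAt (fun t => mellinW W.toFun (s t)) (-t₁ - t₂) :=
      ((W.differentiable_mellinW (by linarith)).continuous.comp hs).continuousAt
    have hz : riemannZeta (2 * s (-t₁ - t₂) + s₁ + s₂ - 2) * riemannZeta s₁ * riemannZeta s₂ ≠ 0 :=
      mul_ne_zero (mul_ne_zero
        (riemannZeta_ne_zero hRH (by simp [re3, re1, re2]; norm_num))
        (riemannZeta_ne_zero hRH (by rw [re1]; norm_num)))
        (riemannZeta_ne_zero hRH (by rw [re2]; norm_num))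
    exact (((((((c1.mul c2).mul c3).div ((c4.mul_const _).mul_const _) hz).mul c5).mul_const _).mul
      c6).mul_const _).mul_const _
  · have z1 := riemannZeta_ne_zero hRH (s := s (-t₁ - t₂)) (by rw [re3]; norm_num)
    have z2 := riemannZeta_ne_zero hRH (s := s (-t₁ - t₂) + s₁ - 1)
      (by simp [re3, re1]; norm_num)
    have z3 := riemannZeta_ne_zero hRH (s := s (-t₁ - t₂) + s₂ - 1)
      (by simp [re3, re2]; norm_num)
    have z4 := riemannZeta_ne_zero hRH (s := 2 * s (-t₁ - t₂) + s₁ + s₂ - 2)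
      (by simp [re3, re1, re2]; norm_num)
    have z5 := riemannZeta_ne_zero hRH (s := s₁) (by rw [re1]; norm_num)
    have z6 := riemannZeta_ne_zero hRH (s := s₂) (by rw [re2]; norm_num)
    have z7 : (y : ℂ) ^ s (-t₁ - t₂) ≠ 0 := cpow_ne_zero_iff.mpr (Or.inl hyC)
    have z8 : (x : ℂ) ^ (s₁ + s₂) ≠ 0 := cpow_ne_zero_iff.mpr (Or.inl hxC)
    have z9 : mellinW W.toFun (s (-t₁ - t₂)) ≠ 0 := h3
    positivity
  · intro t
    have : s t + s₁ + s₂ - 2 = 1 + (t - (-t₁ - t₂) : ℝ) * I := by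
      simp only [s, hs₁, hs₂]; push_cast; ring
    rw [← this, RIntegrand]
    ring

/-- The contour passes through the pole of `ζ(s₃ + s₁ - 1)`. -/
lemma VI_RIntegrand_eq_zero_of_left {U : ℝ} (hRH : RiemannHypothesis) (hU : 1 < U) (W : Weight U)
    {x y : ℝ} (hx : 0 < x) (hy : 0 < y) {t₁ t₂ : ℝ} {s₁ s₂ : ℂ}
    (hs₁ : s₁ = (5 / 4 : ℝ) + t₁ * I) (hs₂ : s₂ = (5 / 4 : ℝ) + t₂ * I) (ht : t₁ ≠ t₂)
    (h1 : mellinW W.toFun s₁ ≠ 0) (h2 : mellinW W.toFun s₂ ≠ 0)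
    (h3 : mellinW W.toFun ((3 / 4 : ℝ) + (-t₁ : ℝ) * I) ≠ 0) :
    VI (3 / 4) (RIntegrand W.toFun x y s₁ s₂) = 0 := by
  have hxC : (x : ℂ) ≠ 0 := ofReal_ne_zero.mpr hx.ne'
  have hyC : (y : ℂ) ≠ 0 := ofReal_ne_zero.mpr hy.ne'
  let s (t : ℝ) : ℂ := (3 / 4 : ℝ) + t * I
  have hs : Continuous s := by fun_prop
  have re1 : s₁.re = 5 / 4 := by simp [hs₁]
  have re2 : s₂.re = 5 / 4 := by simp [hs₂]
  have re3 (t : ℝ) : (s t).re = 3 / 4 := by simp [s]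
  have hne {z : ℂ} (hz : z.re ≠ 1) : z ≠ 1 := fun h => hz (by simp [h])
  refine VI_eq_zero_of_pole (t₀ := -t₁) (φ := fun t =>
    riemannZeta (s t) * riemannZeta (s t + s₂ - 1) * riemannZeta (s t + s₁ + s₂ - 2) /
      (riemannZeta (2 * s t + s₁ + s₂ - 2) * riemannZeta s₁ * riemannZeta s₂) *
    (y : ℂ) ^ s t * (x : ℂ) ^ (s₁ + s₂) *
    mellinW W.toFun (s t) * mellinW W.toFun s₁ * mellinW W.toFun s₂) ?_ ?_ ?_
  · have hne1 : s (-t₁) + s₂ - 1 ≠ 1 := by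
      intro h
      have := congrArg im h
      simp [s, hs₂] at this
      exact ht (by linarith)
    have c1 : ContinuousAt (fun t => riemannZeta (s t)) (-t₁) :=
      continuousAt_riemannZeta_line hs (hne (by rw [re3]; norm_num))
    have c2 : ContinuousAt (fun t => riemannZeta (s t + s₂ - 1)) (-t₁) :=
      continuousAt_riemannZeta_line (by fun_prop) hne1
    have c3 : ContinuousAt (fun t => riemannZeta (s t + s₁ + s₂ - 2)) (-t₁) :=
      continuousAt_riemannZeta_line (by fun_prop) (hne (by simp [re3, re1, re2]; norm_num))
    have c4 : ContinuousAt (fun t => riemannZeta (2 * s t + s₁ + s₂ - 2)) (-t₁) :=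
      continuousAt_riemannZeta_line (by fun_prop) (hne (by simp [re3, re1, re2]; norm_num))
    have c5 : ContinuousAt (fun t => (y : ℂ) ^ s t) (-t₁) :=
      hs.continuousAt.const_cpow (Or.inl hyC)
    have c6 : ContinuousAt (fun t => mellinW W.toFun (s t)) (-t₁) :=
      ((W.differentiable_mellinW (by linarith)).continuous.comp hs).continuousAt
    have hz : riemannZeta (2 * s (-t₁) + s₁ + s₂ - 2) * riemannZeta s₁ * riemannZeta s₂ ≠ 0 :=
      mul_ne_zero (mul_ne_zero
        (riemannZeta_ne_zero hRH (by simp [re3, re1, re2]; norm_num))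
        (riemannZeta_ne_zero hRH (by rw [re1]; norm_num)))
        (riemannZeta_ne_zero hRH (by rw [re2]; norm_num))
    exact (((((((c1.mul c2).mul c3).div ((c4.mul_const _).mul_const _) hz).mul c5).mul_const _).mul
      c6).mul_const _).mul_const _
  · have z1 := riemannZeta_ne_zero hRH (s := s (-t₁)) (by rw [re3]; norm_num)
    have z2 := riemannZeta_ne_zero hRH (s := s (-t₁) + s₂ - 1)
      (by simp [re3, re2]; norm_num)
    have z3 := riemannZeta_ne_zero hRH (s := s (-t₁) + s₁ + s₂ - 2)
      (by simp [re3, re1, re2]; norm_num)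
    have z4 := riemannZeta_ne_zero hRH (s := 2 * s (-t₁) + s₁ + s₂ - 2)
      (by simp [re3, re1, re2]; norm_num)
    have z5 := riemannZeta_ne_zero hRH (s := s₁) (by rw [re1]; norm_num)
    have z6 := riemannZeta_ne_zero hRH (s := s₂) (by rw [re2]; norm_num)
    have z7 : (y : ℂ) ^ s (-t₁) ≠ 0 := cpow_ne_zero_iff.mpr (Or.inl hyC)
    have z8 : (x : ℂ) ^ (s₁ + s₂) ≠ 0 := cpow_ne_zero_iff.mpr (Or.inl hxC)
    have z9 : mellinW W.toFun (s (-t₁)) ≠ 0 := h3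
    positivity
  · intro t
    have : s t + s₁ - 1 = 1 + (t - (-t₁) : ℝ) * I := by
      simp only [s, hs₁]; push_cast; ring
    rw [← this, RIntegrand]
    ring

lemma injective_ofReal_add_mul_I (c : ℝ) : Function.Injective fun t : ℝ => (c : ℂ) + t * I :=
  fun a b h => by simpa using h

lemma VI_VI_VI_RIntegrand_eq_zero {U : ℝ} (hRH : RiemannHypothesis) (hU : 1 < U) (W : Weight U)
    {c : ℝ} (hc : c = 9 / 8 ∨ c = 5 / 4) {x y : ℝ} (hx : 0 < x) (hy : 0 < y) :
    VI c (fun s₁ => VI c fun s₂ => VI (3 / 4) (RIntegrand W.toFun x y s₁ s₂)) = 0 := by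
  have hW := W.ae_mellinW_ne_zero hU (injective_ofReal_add_mul_I c)
  refine VI_eq_zero_of_ae ?_
  rcases hc with rfl | rfl
  · filter_upwards [hW] with t₁ h1
    refine VI_eq_zero_of_ae ?_
    have h3 := W.ae_mellinW_ne_zero hU
      ((injective_ofReal_add_mul_I (3 / 4)).comp (sub_right_injective (b := -t₁)))
    filter_upwards [hW, h3] with t₂ h2 h3
    exact VI_RIntegrand_eq_zero_of_sum hRH hU W hx hy rfl rfl h1 h2 h3
  · have h3 := W.ae_mellinW_ne_zero hU
      ((injective_ofReal_add_mul_I (3 / 4)).comp neg_injective)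
    filter_upwards [hW, h3] with t₁ h1 h3
    refine VI_eq_zero_of_ae ?_
    filter_upwards [hW, MeasureTheory.Measure.ae_ne MeasureTheory.volume t₁] with t₂ h2 ht
    exact VI_RIntegrand_eq_zero_of_left hRH hU W hx hy rfl rfl ht.symm h1 h2 h3

/-- Off the poles, the integrand decays quadratically in each variable. -/
lemma exists_norm_RIntegrand_le {U : ℝ} (hRH : RiemannHypothesis) (hU : 0 < U) (W : Weight U)
    {ε : ℝ} (hε : 0 < ε) (h₁ : ε ≠ 5 / 4) (h₂ : ε ≠ 3 / 2) :
    ∃ C : ℝ, 0 < C ∧ ∀ x y : ℝ, 0 < x → 0 < y → ∀ t₁ t₂ t₃ : ℝ,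
      ‖RIntegrand W.toFun x y ((1 / 2 + ε / 2 : ℝ) + t₁ * I) ((1 / 2 + ε / 2 : ℝ) + t₂ * I)
        ((3 / 4 : ℝ) + t₃ * I)‖ ≤
      C * (y ^ ((3 : ℝ) / 4) * x ^ (1 + ε)) * (1 + t₁ ^ 2)⁻¹ * (1 + t₂ ^ 2)⁻¹ *
        (1 + t₃ ^ 2)⁻¹ := by
  obtain ⟨K₁, hK₁, A₁, hz₁⟩ := exists_norm_riemannZeta_le (c := 3 / 4) (by norm_num) (by norm_num)
  obtain ⟨K₂, hK₂, A₂, hz₂⟩ := exists_norm_riemannZeta_le (c := 1 / 4 + ε / 2) (by linarith)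
    (fun h => h₂ (by linarith))
  obtain ⟨K₃, hK₃, A₃, hz₃⟩ := exists_norm_riemannZeta_le (c := -1 / 4 + ε) (by linarith)
    (fun h => h₁ (by linarith))
  obtain ⟨K₄, hK₄, A₄, hz₄⟩ := exists_norm_inv_riemannZeta_le hRH (c := 1 / 2 + ε) (by linarith)
  obtain ⟨K₅, hK₅, A₅, hz₅⟩ := exists_norm_inv_riemannZeta_le hRH (c := 1 / 2 + ε / 2)
    (by linarith)
  set A := A₁ + A₂ + A₃ + A₄ + A₅ with hA
  obtain ⟨D, hD, hDt⟩ := W.exists_norm_mellinW_mul_le hU (1 / 2 + ε / 2) (4 * A)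
  obtain ⟨D₃, hD₃, hD₃t⟩ := W.exists_norm_mellinW_mul_le hU (3 / 4) (6 * A)
  have hJ (t : ℝ) : 1 ≤ 1 + |t| := by simp
  have hJA {K z t J : ℝ} {B : ℕ} (hK : 0 < K) (hB : B ≤ A) (h : z ≤ K * (1 + |t|) ^ B)
      (hJ' : 1 + |t| ≤ J) : z ≤ K * J ^ A := by
    refine h.trans ?_
    gcongr
    exact (pow_le_pow_right₀ (hJ t) hB).trans (by gcongr)
  refine ⟨K₁ * K₂ * K₂ * K₃ * (K₄ * K₅ * K₅) * D₃ * D * D, by positivity,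
    fun x y hx hy t₁ t₂ t₃ => ?_⟩
  set J₁ := 1 + |t₁| with hJ₁
  set J₂ := 1 + |t₂| with hJ₂
  set J₃ := 1 + |t₃| with hJ₃
  have g1 : 1 ≤ J₁ := hJ t₁
  have g2 : 1 ≤ J₂ := hJ t₂
  have g3 : 1 ≤ J₃ := hJ t₃
  have h31 : 1 + |t₃ + t₁| ≤ J₃ * J₁ := by nlinarith [abs_add_le t₃ t₁, abs_nonneg t₁, abs_nonneg t₃]
  have h32 : 1 + |t₃ + t₂| ≤ J₃ * J₂ := by nlinarith [abs_add_le t₃ t₂, abs_nonneg t₂, abs_nonneg t₃]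
  have h312 : 1 + |t₃ + t₁ + t₂| ≤ J₃ * J₁ * J₂ := by
    nlinarith [abs_add_le (t₃ + t₁) t₂, abs_nonneg t₂, abs_nonneg (t₃ + t₁)]
  have h3312 : 1 + |2 * t₃ + t₁ + t₂| ≤ J₃ * (J₃ * J₁ * J₂) := by
    have : 2 * t₃ + t₁ + t₂ = t₃ + (t₃ + t₁ + t₂) := by ring
    rw [this]
    nlinarith [abs_add_le t₃ (t₃ + t₁ + t₂), abs_nonneg t₃, abs_nonneg (t₃ + t₁ + t₂)]
  set s₁ : ℂ := (1 / 2 + ε / 2 : ℝ) + t₁ * I with hs₁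
  set s₂ : ℂ := (1 / 2 + ε / 2 : ℝ) + t₂ * I with hs₂
  set s₃ : ℂ := (3 / 4 : ℝ) + t₃ * I with hs₃
  have e1 : s₃ + s₁ - 1 = (1 / 4 + ε / 2 : ℝ) + (t₃ + t₁ : ℝ) * I := by
    rw [hs₃, hs₁]; push_cast; ring
  have e2 : s₃ + s₂ - 1 = (1 / 4 + ε / 2 : ℝ) + (t₃ + t₂ : ℝ) * I := by
    rw [hs₃, hs₂]; push_cast; ring
  have e3 : s₃ + s₁ + s₂ - 2 = (-1 / 4 + ε : ℝ) + (t₃ + t₁ + t₂ : ℝ) * I := by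
    rw [hs₃, hs₁, hs₂]; push_cast; ring
  have e4 : 2 * s₃ + s₁ + s₂ - 2 = (1 / 2 + ε : ℝ) + (2 * t₃ + t₁ + t₂ : ℝ) * I := by
    rw [hs₃, hs₁, hs₂]; push_cast; ring
  have b1 : ‖riemannZeta s₃‖ ≤ K₁ * J₃ ^ A := hJA hK₁ (by omega) (hz₁ t₃) le_rfl
  have b2 : ‖riemannZeta (s₃ + s₁ - 1)‖ ≤ K₂ * (J₃ * J₁) ^ A :=
    hJA hK₂ (by omega) (e1 ▸ hz₂ (t₃ + t₁)) h31
  have b3 : ‖riemannZeta (s₃ + s₂ - 1)‖ ≤ K₂ * (J₃ * J₂) ^ A :=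
    hJA hK₂ (by omega) (e2 ▸ hz₂ (t₃ + t₂)) h32
  have b4 : ‖riemannZeta (s₃ + s₁ + s₂ - 2)‖ ≤ K₃ * (J₃ * J₁ * J₂) ^ A :=
    hJA hK₃ (by omega) (e3 ▸ hz₃ (t₃ + t₁ + t₂)) h312
  have b5 : ‖riemannZeta (2 * s₃ + s₁ + s₂ - 2)‖⁻¹ ≤ K₄ * (J₃ * (J₃ * J₁ * J₂)) ^ A :=
    hJA hK₄ (by omega) (e4 ▸ hz₄ (2 * t₃ + t₁ + t₂)) h3312
  have b6 : ‖riemannZeta s₁‖⁻¹ ≤ K₅ * J₁ ^ A := hJA hK₅ (by omega) (hz₅ t₁) le_rfl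
  have b7 : ‖riemannZeta s₂‖⁻¹ ≤ K₅ * J₂ ^ A := hJA hK₅ (by omega) (hz₅ t₂) le_rfl
  have n1 : ‖(y : ℂ) ^ s₃‖ = y ^ ((3 : ℝ) / 4) := by
    rw [norm_cpow_eq_rpow_re_of_pos hy]; simp [hs₃]
  have n2 : ‖(x : ℂ) ^ (s₁ + s₂)‖ = x ^ (1 + ε) := by
    rw [norm_cpow_eq_rpow_re_of_pos hx]
    congr 1
    simp [hs₁, hs₂]; ring
  set P := y ^ ((3 : ℝ) / 4) * x ^ (1 + ε) with hP
  have hP0 : 0 ≤ P := by positivity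
  have m1 : ‖mellinW W.toFun s₁‖ * J₁ ^ (4 * A) ≤ D * (1 + t₁ ^ 2)⁻¹ := hDt t₁
  have m2 : ‖mellinW W.toFun s₂‖ * J₂ ^ (4 * A) ≤ D * (1 + t₂ ^ 2)⁻¹ := hDt t₂
  have m3 : ‖mellinW W.toFun s₃‖ * J₃ ^ (6 * A) ≤ D₃ * (1 + t₃ ^ 2)⁻¹ := hD₃t t₃
  calc ‖RIntegrand W.toFun x y s₁ s₂ s₃‖
      = ‖riemannZeta s₃‖ * ‖riemannZeta (s₃ + s₁ - 1)‖ * ‖riemannZeta (s₃ + s₂ - 1)‖ *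
          ‖riemannZeta (s₃ + s₁ + s₂ - 2)‖ *
          (‖riemannZeta (2 * s₃ + s₁ + s₂ - 2)‖⁻¹ * ‖riemannZeta s₁‖⁻¹ * ‖riemannZeta s₂‖⁻¹) *
          P * ‖mellinW W.toFun s₃‖ * ‖mellinW W.toFun s₁‖ * ‖mellinW W.toFun s₂‖ := by
        simp only [RIntegrand, norm_mul, norm_inv, n1, n2, hP, div_eq_mul_inv, mul_inv]
        ring
    _ ≤ (K₁ * J₃ ^ A) * (K₂ * (J₃ * J₁) ^ A) * (K₂ * (J₃ * J₂) ^ A) *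
          (K₃ * (J₃ * J₁ * J₂) ^ A) *
          ((K₄ * (J₃ * (J₃ * J₁ * J₂)) ^ A) * (K₅ * J₁ ^ A) * (K₅ * J₂ ^ A)) *
          P * ‖mellinW W.toFun s₃‖ * ‖mellinW W.toFun s₁‖ * ‖mellinW W.toFun s₂‖ := by
        gcongr
    _ = K₁ * K₂ * K₂ * K₃ * (K₄ * K₅ * K₅) * P * (‖mellinW W.toFun s₃‖ * J₃ ^ (6 * A)) *
          (‖mellinW W.toFun s₁‖ * J₁ ^ (4 * A)) * (‖mellinW W.toFun s₂‖ * J₂ ^ (4 * A)) := by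
        ring_nf
    _ ≤ K₁ * K₂ * K₂ * K₃ * (K₄ * K₅ * K₅) * P * (D₃ * (1 + t₃ ^ 2)⁻¹) *
          (D * (1 + t₁ ^ 2)⁻¹) * (D * (1 + t₂ ^ 2)⁻¹) := by
        exact mul_le_mul (mul_le_mul (mul_le_mul_of_nonneg_left m3 (by positivity)) m1
          (by positivity) (by positivity)) m2 (by positivity) (by positivity)
    _ = _ := by ring

/-- Under RH, the bound `R ≪ y^{3/4} x^{1+ε}` for the triple integral with
`c₁ = c₂ = 1/2 + ε/2` and `c₃' = 3/4`. -/
theorem R_bound (hRH : RiemannHypothesis) (ε : ℝ) (hε : 0 < ε)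
    (U : ℝ) (hU : 2 ≤ U) (W : Weight U) :
    ∃ C : ℝ, 0 < C ∧ ∃ X : ℝ, ∀ x y : ℝ, X ≤ x → x < y →
      ‖VI (1 / 2 + ε / 2) (fun s₁ => VI (1 / 2 + ε / 2) (fun s₂ => VI (3 / 4) (fun s₃ =>
          riemannZeta s₃ * riemannZeta (s₃ + s₁ - 1) * riemannZeta (s₃ + s₂ - 1) *
              riemannZeta (s₃ + s₁ + s₂ - 2) /
              (riemannZeta (2 * s₃ + s₁ + s₂ - 2) * riemannZeta s₁ * riemannZeta s₂) *
            (y : ℂ) ^ s₃ * (x : ℂ) ^ (s₁ + s₂) *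
            mellinW W.toFun s₃ * mellinW W.toFun s₁ * mellinW W.toFun s₂)))‖ ≤
        C * (y ^ ((3 : ℝ) / 4) * x ^ (1 + ε)) := by
  change ∃ C : ℝ, 0 < C ∧ ∃ X : ℝ, ∀ x y : ℝ, X ≤ x → x < y →
      ‖VI (1 / 2 + ε / 2) (fun s₁ => VI (1 / 2 + ε / 2) fun s₂ =>
        VI (3 / 4) (RIntegrand W.toFun x y s₁ s₂))‖ ≤ C * (y ^ ((3 : ℝ) / 4) * x ^ (1 + ε))
  by_cases h : ε = 5 / 4 ∨ ε = 3 / 2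
  · have hc : 1 / 2 + ε / 2 = 9 / 8 ∨ 1 / 2 + ε / 2 = 5 / 4 :=
      h.imp (fun h => by rw [h]; norm_num) (fun h => by rw [h]; norm_num)
    refine ⟨1, one_pos, 1, fun x y hx hxy => ?_⟩
    have hx0 : 0 < x := by linarith
    have hy0 : 0 < y := by linarith
    rw [VI_VI_VI_RIntegrand_eq_zero hRH (by linarith) W hc hx0 hy0, norm_zero]
    positivity
  · rw [not_or] at h
    obtain ⟨C, hC, hb⟩ := exists_norm_RIntegrand_le hRH (by linarith) W hε h.1 h.2
    refine ⟨C, hC, 1, fun x y hx hxy => ?_⟩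
    have hx0 : 0 < x := by linarith
    have hy0 : 0 < y := by linarith
    refine norm_VI_le (by positivity) fun t₁ => ?_
    refine norm_VI_le (by positivity) fun t₂ => ?_
    exact norm_VI_le (by positivity) fun t₃ => hb x y hx0 hy0 t₁ t₂ t₃
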